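/- Let A be a proper analytic subset of a complex Hilbert manifold 𝒳 and h a bounded holomorphic function on 𝒳 \ A. Then h extends holomorphically to 𝒳. -/

import Mathlib

noncomputable section
open Set Metric

/-- The model separable Hilbert space ℓ². -/
abbrev EllTwo : Type := lp (fun _ : ℕ => ℂ) 2

/-- A meromorphic function on an open subset `U` of a complex normed space:
locally a quotient `h/g` of holomorphic functions with `g ≢ 0`. -/
def MeromorphicOnSet {E : Type*} [NormedAddCommGroup E] [NormedSpace ℂ E]
    (f : E → ℂ) (U : Set E) : Prop :=
  ∀ a ∈ U, ∃ V : Set E, IsOpen V ∧ a ∈ V ∧ V ⊆ U ∧ ∃ h g : E → ℂ,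
    DifferentiableOn ℂ h V ∧ DifferentiableOn ℂ g V ∧ (∃ z ∈ V, g z ≠ 0) ∧
    ∀ z ∈ V, g z ≠ 0 → f z = h z / g z

/-- A Hilbert analytic subset of an open set `U`: locally the zero set of a
holomorphic map with values in a separable complex Hilbert space. -/
def IsHilbertAnalyticIn {E : Type*} [NormedAddCommGroup E] [NormedSpace ℂ E]
    (A U : Set E) : Prop :=
  A ⊆ U ∧ ∀ a ∈ U, ∃ V : Set E, IsOpen V ∧ a ∈ V ∧ V ⊆ U ∧
    ∃ h : E → EllTwo, DifferentiableOn ℂ h V ∧ A ∩ V = {z ∈ V | h z = 0}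

/-- The germ of `A` at `a` has codimension at least `p`: there is a
`p`-dimensional linear subspace `T` such that, locally near `a`, the affine
subspace `a + T` meets `A` only at `a`. -/
def GermCodimAtLeast {E : Type*} [NormedAddCommGroup E] [NormedSpace ℂ E]
    (A : Set E) (a : E) (p : ℕ) : Prop :=
  ∃ T : Submodule ℂ E, Module.finrank ℂ T = p ∧ ∃ V : Set E, IsOpen V ∧ a ∈ V ∧
    ∀ z ∈ A ∩ V, z - a ∈ (T : Set E) → z = a

/-- `A` contains a principal germ at `a`: the germ of the zero set of a single
holomorphic function vanishing at `a` (and not identically zero) is contained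
in `A`. -/
def ContainsPrincipalGermAt {E : Type*} [NormedAddCommGroup E] [NormedSpace ℂ E]
    (A : Set E) (a : E) : Prop :=
  ∃ V : Set E, IsOpen V ∧ a ∈ V ∧ ∃ f : E → ℂ,
    DifferentiableOn ℂ f V ∧ f a = 0 ∧ (∃ z ∈ V, f z ≠ 0) ∧
    ∃ W : Set E, IsOpen W ∧ a ∈ W ∧ W ⊆ V ∧ {z ∈ W | f z = 0} ⊆ A

open Filter Topology in
/-- A holomorphic function on a disc that is not identically zero has isolated zeros. -/
theorem eventually_ne_zero_of_differentiableOn_ball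
    {F : Type*} [NormedAddCommGroup F] [NormedSpace ℂ F] [CompleteSpace F]
    {g : ℂ → F} {R : ℝ} (hg : DifferentiableOn ℂ g (ball 0 R))
    (hne : ∃ t ∈ ball (0 : ℂ) R, g t ≠ 0) {t : ℂ} (ht : t ∈ ball (0 : ℂ) R) :
    ∀ᶠ s in 𝓝[≠] t, g s ≠ 0 := by
  by_contra hfreq
  obtain ⟨t₁, ht₁, hgt₁⟩ := hne
  refine hgt₁ ((hg.analyticOnNhd isOpen_ball).eqOn_zero_of_preconnected_of_frequently_eq_zero
    (convex_ball 0 R).isPreconnected ht ?_ ht₁)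
  exact fun hev => hfreq hev

open Filter Topology in
/-- The mean value property for bounded functions that are holomorphic off the zero set of a
nontrivial holomorphic map. -/
theorem circleAverage_eq_of_bounded_off_zeros
    {F : Type*} [NormedAddCommGroup F] [NormedSpace ℂ F] [CompleteSpace F]
    {g : ℂ → F} {k : ℂ → ℂ} {R ρ M : ℝ} (hρ : 0 < ρ) (hρR : ρ < R)
    (hg : DifferentiableOn ℂ g (ball 0 R))
    (hsphere : ∀ t ∈ sphere (0 : ℂ) ρ, g t ≠ 0) (h0 : g 0 ≠ 0)
    (hk : ∀ t ∈ ball (0 : ℂ) R, g t ≠ 0 → DifferentiableAt ℂ k t)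
    (hM : ∀ t ∈ ball (0 : ℂ) R, g t ≠ 0 → ‖k t‖ ≤ M) :
    Real.circleAverage k 0 ρ = k 0 := by
  have h0R : (0 : ℂ) ∈ ball (0 : ℂ) R := mem_ball_self (hρ.trans hρR)
  set K : ℂ → ℂ := fun t => limUnder (𝓝[≠] t) k with hKdef
  have hKeq : ∀ t ∈ ball (0 : ℂ) R, g t ≠ 0 → K t = k t := fun t ht hgt =>
    ((hk t ht hgt).continuousAt.tendsto.mono_left nhdsWithin_le_nhds).limUnder_eq
  have hKdiff : DifferentiableOn ℂ K (ball 0 R) := by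
    intro t ht
    have hev : ∀ᶠ s in 𝓝 t, s ∈ ball (0 : ℂ) R ∧ (s ≠ t → g s ≠ 0) :=
      Filter.Eventually.and (isOpen_ball.mem_nhds ht) (eventually_nhdsWithin_iff.1
        (eventually_ne_zero_of_differentiableOn_ball hg ⟨0, h0R, h0⟩ ht))
    set S : Set ℂ := {s | s ∈ ball (0 : ℂ) R ∧ (s ≠ t → g s ≠ 0)}
    have hSt : S ∈ 𝓝 t := hev
    have hupd := Complex.differentiableOn_update_limUnder_of_bddAbove (f := k) hSt
      (fun s hs => (hk s hs.1.1 (hs.1.2 hs.2)).differentiableWithinAt)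
      ⟨M, by rintro _ ⟨s, hs, rfl⟩; exact hM s hs.1.1 (hs.1.2 hs.2)⟩
    refine ((hupd.differentiableAt hSt).congr_of_eventuallyEq ?_).differentiableWithinAt
    filter_upwards [hSt] with s hs
    by_cases hst : s = t
    · subst hst; simp [hKdef]
    · rw [Function.update_of_ne hst, hKeq s hs.1 (hs.2 hst)]
  have hsub : closedBall (0 : ℂ) |ρ| ⊆ ball 0 R := by
    rw [abs_of_pos hρ]; exact closedBall_subset_ball hρR
  calc Real.circleAverage k 0 ρ = Real.circleAverage K 0 ρ := by
        refine Real.circleAverage_congr_sphere fun t ht => ?_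
        rw [hKeq t (hsub (sphere_subset_closedBall ht)) (hsphere t (by rwa [abs_of_pos hρ] at ht))]
    _ = K 0 := circleAverage_of_differentiable_on_off_countable countable_empty
        (hKdiff.continuousOn.mono hsub)
        fun t ht => hKdiff.differentiableAt (isOpen_ball.mem_nhds (hsub (ball_subset_closedBall ht.1)))
    _ = k 0 := hKeq 0 h0R h0

/-- A bounded holomorphic function on an open set has derivative bounded by its supremum divided by
the distance to the complement. -/
theorem norm_fderiv_le_of_bounded
    {E : Type*} [NormedAddCommGroup E] [NormedSpace ℂ E] {h : E → ℂ} {z : E} {r M : ℝ}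
    (hr : 0 < r) (hh : DifferentiableOn ℂ h (ball z r)) (hM : ∀ w ∈ ball z r, ‖h w‖ ≤ M) :
    ‖fderiv ℂ h z‖ ≤ 2 * M / r := by
  refine Complex.norm_fderiv_le_div_of_mapsTo_ball hh (fun w hw => ?_) hr
  rw [mem_closedBall, dist_eq_norm]
  have := norm_sub_le (h w) (h z)
  linarith [hM w hw, hM z (mem_ball_self hr)]

open Filter Topology in
/-- Averages of translates of a bounded holomorphic function along a circle depend
holomorphically on the centre. -/
theorem differentiableAt_circleAverage_translate
    {E : Type*} [NormedAddCommGroup E] [InnerProductSpace ℂ E] [CompleteSpace E]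
    [TopologicalSpace.SeparableSpace E]
    {W : Set E} (hW : IsOpen W) {h : E → ℂ} (hh : DifferentiableOn ℂ h W) {M : ℝ}
    (hM : ∀ z ∈ W, ‖h z‖ ≤ M) {v w : E} {ρ r : ℝ} (hρ : 0 ≤ ρ) (hr : 0 < r)
    (hball : ∀ t ∈ sphere (0 : ℂ) ρ, ball (w + t • v) r ⊆ W) :
    DifferentiableAt ℂ (fun x => Real.circleAverage (fun t => h (x + t • v)) 0 ρ) w := by
  borelize E
  have : SecondCountableTopology (E →L[ℂ] ℂ) :=
    (InnerProductSpace.toDual ℂ E).toHomeomorph.symm.isEmbedding.secondCountableTopology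
  set γ : ℝ → E := fun θ => circleMap 0 ρ θ • v
  have hγ : Continuous γ := (continuous_circleMap 0 ρ).smul continuous_const
  have hsub : ∀ θ, ∀ x ∈ ball w (r / 2), ball (x + γ θ) (r / 2) ⊆ W := by
    intro θ x hx y hy
    refine hball _ (circleMap_mem_sphere 0 hρ θ) ?_
    rw [mem_ball] at hx hy ⊢
    have h1 := dist_triangle y (x + γ θ) (w + γ θ)
    rw [dist_add_right] at h1
    change dist y (w + γ θ) < r
    linarith
  have hmem : ∀ θ, ∀ x ∈ ball w (r / 2), x + γ θ ∈ W := fun θ x hx =>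
    hsub θ x hx (mem_ball_self (half_pos hr))
  have hcont : ∀ x ∈ ball w (r / 2), Continuous fun θ => h (x + γ θ) := fun x hx =>
    hh.continuousOn.comp_continuous (continuous_const.add hγ) fun θ => hmem θ x hx
  have hs : ball w (r / 2) ∈ 𝓝 w := ball_mem_nhds w (half_pos hr)
  have key := intervalIntegral.hasFDerivAt_integral_of_dominated_of_fderiv_le (𝕜 := ℂ)
    (μ := MeasureTheory.volume) (a := 0) (b := 2 * Real.pi)
    (F := fun x θ => h (x + γ θ)) (F' := fun x θ => fderiv ℂ h (x + γ θ)) (x₀ := w)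
    (bound := fun _ => 2 * M / (r / 2)) hs
    (by filter_upwards [hs] with x hx using (hcont x hx).aestronglyMeasurable)
    ((hcont w (mem_ball_self (half_pos hr))).intervalIntegrable _ _)
    (((measurable_fderiv ℂ h).comp
      (continuous_const.add hγ).measurable).stronglyMeasurable.aestronglyMeasurable)
    (Eventually.of_forall fun θ _ x hx => norm_fderiv_le_of_bounded (half_pos hr)
      (hh.mono (hsub θ x hx)) fun y hy => hM y (hsub θ x hx hy))
    intervalIntegrable_const
    (Eventually.of_forall fun θ _ x hx =>
      (hasFDerivAt_comp_add_right (γ θ)).2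
        (hh.differentiableAt (hW.mem_nhds (hmem θ x hx))).hasFDerivAt)
  exact key.differentiableAt.const_smul ((2 * Real.pi)⁻¹ : ℝ)

open Filter Topology in
/-- Local form of the removable singularity theorem, off the zero set of a holomorphic map on a
ball which does not vanish identically. -/
theorem exists_local_extension_off_zeros
    {E : Type*} [NormedAddCommGroup E] [InnerProductSpace ℂ E] [CompleteSpace E]
    [TopologicalSpace.SeparableSpace E]
    {F : Type*} [NormedAddCommGroup F] [NormedSpace ℂ F] [CompleteSpace F]
    {a : E} {R M : ℝ} {f : E → F} {h : E → ℂ}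
    (hf : DifferentiableOn ℂ f (ball a R)) (hne : ∃ z ∈ ball a R, f z ≠ 0)
    (hh : DifferentiableOn ℂ h {z ∈ ball a R | f z ≠ 0})
    (hM : ∀ z ∈ {z ∈ ball a R | f z ≠ 0}, ‖h z‖ ≤ M) :
    ∃ δ > 0, ball a δ ⊆ ball a R ∧ ball a δ ⊆ closure {z ∈ ball a R | f z ≠ 0} ∧
      ∃ G : E → ℂ, DifferentiableOn ℂ G (ball a δ) ∧ ∀ z ∈ ball a δ, f z ≠ 0 → G z = h z := by
  set W : Set E := {z ∈ ball a R | f z ≠ 0}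
  have hW : IsOpen W := hf.continuousOn.isOpen_inter_preimage isOpen_ball isOpen_ne
  obtain ⟨z₀, hz₀, hfz₀⟩ := hne
  have hR : 0 < R := pos_of_mem_ball hz₀
  set v : E := z₀ - a with hv
  have hvR : ‖v‖ < R := by rwa [mem_ball, dist_eq_norm] at hz₀
  obtain ⟨T, hT1, hTv⟩ : ∃ T : ℝ, 1 < T ∧ T * ‖v‖ < R := by
    have hp : 0 < ‖v‖ + 1 := by positivity
    refine ⟨(R + 1) / (‖v‖ + 1), ?_, ?_⟩
    · rw [one_lt_div hp]; linarith
    · rw [div_mul_eq_mul_div, div_lt_iff₀ hp]; nlinarith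
  have hT : 0 < T := one_pos.trans hT1
  have hline : ∀ w : E, ‖w - a‖ < R - T * ‖v‖ → ∀ t ∈ ball (0 : ℂ) T, w + t • v ∈ ball a R := by
    intro w hw t ht
    rw [mem_ball_zero_iff] at ht
    rw [mem_ball, dist_eq_norm, add_sub_right_comm]
    have h1 := norm_add_le (w - a) (t • v)
    rw [norm_smul] at h1
    have h2 : ‖t‖ * ‖v‖ ≤ T * ‖v‖ := by gcongr
    linarith
  have hslice : ∀ w : E, ‖w - a‖ < R - T * ‖v‖ →
      DifferentiableOn ℂ (fun t : ℂ => f (w + t • v)) (ball 0 T) := fun w hw =>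
    hf.comp (by fun_prop) (hline w hw)
  have ha : ‖a - a‖ < R - T * ‖v‖ := by simpa using hTv
  obtain ⟨ρ, hρ, hρT, hρf⟩ : ∃ ρ : ℝ, 0 < ρ ∧ ρ < T ∧
      ∀ t ∈ sphere (0 : ℂ) ρ, f (a + t • v) ≠ 0 := by
    have hev := eventually_ne_zero_of_differentiableOn_ball (hslice a ha)
      ⟨1, by simpa using hT1, by simpa [hv] using hfz₀⟩ (mem_ball_self hT)
    rw [eventually_nhdsWithin_iff, Metric.eventually_nhds_iff] at hev
    obtain ⟨ε, hε, hεf⟩ := hev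
    have hm : 0 < min ε T := lt_min hε hT
    refine ⟨min ε T / 2, half_pos hm, (half_lt_self hm).trans_le (min_le_right _ _), ?_⟩
    intro t ht
    have htn : dist t 0 = min ε T / 2 := ht
    refine hεf ?_ fun h0 => ?_
    · rw [htn]; exact (half_lt_self hm).trans_le (min_le_left _ _)
    · rw [h0, dist_self] at htn; linarith
  have hsT : ∀ t ∈ sphere (0 : ℂ) ρ, t ∈ ball (0 : ℂ) T := fun t ht =>
    closedBall_subset_ball hρT (sphere_subset_closedBall ht)
  obtain ⟨r, hr, hrW⟩ : ∃ r, 0 < r ∧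
      thickening r ((fun t : ℂ => a + t • v) '' sphere (0 : ℂ) ρ) ⊆ W := by
    refine ((isCompact_sphere 0 ρ).image (by fun_prop)).exists_thickening_subset_open hW ?_
    rintro _ ⟨t, ht, rfl⟩
    exact ⟨hline a ha t (hsT t ht), hρf t ht⟩
  have hballW : ∀ w ∈ ball a (r / 2), ∀ t ∈ sphere (0 : ℂ) ρ, ball (w + t • v) (r / 2) ⊆ W := by
    intro w hw t ht y hy
    refine hrW (mem_thickening_iff.2 ⟨_, mem_image_of_mem _ ht, ?_⟩)
    have h1 := dist_triangle y (w + t • v) (a + t • v)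
    rw [dist_add_right] at h1
    rw [mem_ball] at hw hy
    linarith
  have hδ : 0 < min (r / 2) (R - T * ‖v‖) := lt_min (half_pos hr) (sub_pos.2 hTv)
  set δ := min (r / 2) (R - T * ‖v‖)
  have hδr : ball a δ ⊆ ball a (r / 2) := ball_subset_ball (min_le_left _ _)
  have hδR : ∀ w ∈ ball a δ, ‖w - a‖ < R - T * ‖v‖ := fun w hw => by
    rw [mem_ball, dist_eq_norm] at hw
    exact hw.trans_le (min_le_right _ _)
  have hsphere : ∀ w ∈ ball a δ, ∀ t ∈ sphere (0 : ℂ) ρ, f (w + t • v) ≠ 0 := fun w hw t ht =>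
    (hballW w (hδr hw) t ht (mem_ball_self (half_pos hr))).2
  refine ⟨δ, hδ, ball_subset_ball ((min_le_right _ _).trans ?_), fun w hw => ?_,
    fun w => Real.circleAverage (fun t => h (w + t • v)) 0 ρ, fun w hw => ?_, fun w hw hfw => ?_⟩
  · have : 0 ≤ T * ‖v‖ := by positivity
    linarith
  · have hρs : (ρ : ℂ) ∈ sphere (0 : ℂ) ρ := by simp [abs_of_pos hρ]
    have hev := eventually_ne_zero_of_differentiableOn_ball (hslice w (hδR w hw))
      ⟨ρ, hsT _ hρs, hsphere w hw _ hρs⟩ (mem_ball_self hT)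
    have hlim : Tendsto (fun t : ℂ => w + t • v) (𝓝[≠] 0) (𝓝 w) := by
      have hc : Continuous fun t : ℂ => w + t • v := by fun_prop
      simpa using (hc.tendsto 0).mono_left nhdsWithin_le_nhds
    refine mem_closure_of_tendsto hlim ?_
    filter_upwards [hev, nhdsWithin_le_nhds (ball_mem_nhds (0 : ℂ) hT)] with t ht htT
    exact ⟨hline w (hδR w hw) t htT, ht⟩
  · exact (differentiableAt_circleAverage_translate hW hh hM hρ.le (half_pos hr)
      (hballW w (hδr hw))).differentiableWithinAt
  · have := circleAverage_eq_of_bounded_off_zeros (k := fun t => h (w + t • v)) (M := M) hρ hρT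
      (hslice w (hδR w hw)) (hsphere w hw) (by simpa using hfw)
      (fun t ht hft => (hh.differentiableAt
        (hW.mem_nhds ⟨hline w (hδR w hw) t ht, hft⟩)).comp t (by fun_prop))
      (fun t ht hft => hM _ ⟨hline w (hδR w hw) t ht, hft⟩)
    simpa using this

open Filter Topology in
/-- Local holomorphic extensions of `h` from `S` glue, provided that near each point either `S` is
dense or `S` is absent. -/
theorem exists_extension_of_local
    {E : Type*} [NormedAddCommGroup E] [NormedSpace ℂ E] {U S : Set E} {h : E → ℂ} (hSU : S ⊆ U)
    (hloc : ∀ a ∈ U, ∃ V : Set E, IsOpen V ∧ a ∈ V ∧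
      (Disjoint V S ∨ V ⊆ closure S ∧ ∃ G : E → ℂ, DifferentiableOn ℂ G V ∧ EqOn G h (V ∩ S))) :
    ∃ H : E → ℂ, DifferentiableOn ℂ H U ∧ EqOn H h S := by
  classical
  set H : E → ℂ := fun z => if z ∈ closure S then limUnder (𝓝[S] z) h else 0 with hH
  have hHG : ∀ {V : Set E} {G : E → ℂ}, IsOpen V → V ⊆ closure S → DifferentiableOn ℂ G V →
      EqOn G h (V ∩ S) → EqOn H G V := by
    intro V G hV hVS hG hGh z hz
    have : (𝓝[S] z).NeBot := mem_closure_iff_nhdsWithin_neBot.1 (hVS hz)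
    have hlim : Tendsto h (𝓝[S] z) (𝓝 (G z)) := by
      refine ((hG.continuousOn.continuousAt (hV.mem_nhds hz)).tendsto.mono_left
        nhdsWithin_le_nhds).congr' ?_
      filter_upwards [self_mem_nhdsWithin, nhdsWithin_le_nhds (hV.mem_nhds hz)] with y hyS hyV
      exact hGh ⟨hyV, hyS⟩
    simp only [hH, if_pos (hVS hz), hlim.limUnder_eq]
  refine ⟨H, fun a ha => ?_, fun a ha => ?_⟩
  · obtain ⟨V, hV, haV, hdisj | ⟨hVS, G, hG, hGh⟩⟩ := hloc a ha
    · have h0 : H =ᶠ[𝓝 a] fun _ => 0 := by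
        filter_upwards [hV.mem_nhds haV] with z hz
        exact if_neg (disjoint_left.1 (hdisj.closure_right hV) hz)
      exact ((differentiableAt_const 0).congr_of_eventuallyEq h0).differentiableWithinAt
    · exact ((hG.differentiableAt (hV.mem_nhds haV)).congr_of_eventuallyEq
        ((hHG hV hVS hG hGh).eventuallyEq_of_mem (hV.mem_nhds haV))).differentiableWithinAt
  · obtain ⟨V, hV, haV, hdisj | ⟨hVS, G, hG, hGh⟩⟩ := hloc a (hSU ha)
    · exact absurd ha (disjoint_left.1 hdisj haV)
    · exact (hHG hV hVS hG hGh haV).trans (hGh ⟨haV, ha⟩)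

/- STATEMENT 10: Riemann-type removable singularity theorem: a bounded
holomorphic function on the complement of a proper analytic subset A of
(an open piece U of) a complex Hilbert manifold extends holomorphically. -/

theorem bounded_extension_across_analytic
    {E : Type*} [NormedAddCommGroup E] [InnerProductSpace ℂ E] [CompleteSpace E]
    [TopologicalSpace.SeparableSpace E]
    (U : Set E) (hU : IsOpen U)
    (A : Set E) (hA : IsHilbertAnalyticIn A U) (hproper : A ≠ U)
    (h : E → ℂ) (hh : DifferentiableOn ℂ h (U \ A))
    (hbd : ∃ M : ℝ, ∀ z ∈ U \ A, ‖h z‖ ≤ M) :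
    ∃ H : E → ℂ, DifferentiableOn ℂ H U ∧ Set.EqOn H h (U \ A) := by
  obtain ⟨M, hM⟩ := hbd
  refine exists_extension_of_local sdiff_subset fun a ha => ?_
  obtain ⟨V, hV, haV, hVU, f, hf, hAV⟩ := hA.2 a ha
  obtain ⟨R, hR, hRV⟩ := Metric.isOpen_iff.1 hV a haV
  have hiff : ∀ z ∈ ball a R, (z ∈ A ↔ f z = 0) := fun z hz =>
    ⟨fun hzA => (hAV.subset ⟨hzA, hRV hz⟩).2, fun h0 => (hAV.superset ⟨hRV hz, h0⟩).1⟩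
  by_cases hne : ∃ z ∈ ball a R, f z ≠ 0
  · have hsub : {z ∈ ball a R | f z ≠ 0} ⊆ U \ A := fun z hz =>
      ⟨hVU (hRV hz.1), fun hzA => hz.2 ((hiff z hz.1).1 hzA)⟩
    obtain ⟨δ, hδ, hδR, hcl, G, hG, hGh⟩ := exists_local_extension_off_zeros
      (hf.mono hRV) hne (hh.mono hsub) fun z hz => hM z (hsub hz)
    exact ⟨ball a δ, isOpen_ball, mem_ball_self hδ, Or.inr ⟨hcl.trans (closure_mono hsub), G, hG,
      fun z hz => hGh z hz.1 fun h0 => hz.2.2 ((hiff z (hδR hz.1)).2 h0)⟩⟩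
  · push Not at hne
    exact ⟨ball a R, isOpen_ball, mem_ball_self hR, Or.inl <| disjoint_left.2 fun z hz hzS =>
      hzS.2 ((hiff z hz).2 (hne z hz))⟩
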